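/- Every graph G on n ≥ 1 vertices admitting a Δ-disk representation satisfies χ_s(G) ≤ 2·log₂(n) + 1. -/

import Mathlib

/-- A `k`-subcoloring of a simple graph `G`: every color class induces a
disjoint union of cliques. -/
def IsSubcoloring {V : Type*} {k : ℕ} (G : SimpleGraph V) (μ : V → Fin k) : Prop :=
  ∀ u v w : V, μ u = μ v → μ v = μ w → G.Adj u v → G.Adj v w → u ≠ w → G.Adj u w

/-- A Δ-disk representation of a simple graph `G`: each vertex `v` gets a
closed disk with center `c v = (x_v, y_v)`, `x_v > 0`, `y_v > 0`, and radius
`r v` with `max x_v y_v ≤ r v < √(x_v² + y_v²)` (the disk meets both axes but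
misses the origin); distinct vertices are adjacent iff their disks intersect. -/
def IsDeltaDiskRep {V : Type*} (G : SimpleGraph V)
    (c : V → EuclideanSpace ℝ (Fin 2)) (r : V → ℝ) : Prop :=
  (∀ v, 0 < c v 0) ∧ (∀ v, 0 < c v 1) ∧
  (∀ v, max (c v 0) (c v 1) ≤ r v) ∧ (∀ v, r v < dist (c v) 0) ∧
  ∀ u v, u ≠ v → (G.Adj u v ↔
    (Metric.closedBall (c u) (r u) ∩ Metric.closedBall (c v) (r v)).Nonempty)

open Classical in
/-- A median level: both strict sides are small. -/
lemma exists_median_level {V : Type*} (t : V → ℝ) (S : Finset V) (N : ℕ) (hN : 0 < N)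
    (hS : S.card < 2 * N) :
    ∃ a : ℝ, (S.filter (fun v => t v < a)).card < N ∧ (S.filter (fun v => a < t v)).card < N := by
  rcases S.eq_empty_or_nonempty with rfl | hne
  · exact ⟨0, by simpa using hN, by simpa using hN⟩
  obtain ⟨b, hb, hbmin⟩ := S.exists_min_image t hne
  set Q := S.filter (fun v => (S.filter (fun u => t u < t v)).card < N) with hQ
  have hQne : Q.Nonempty := by
    refine ⟨b, Finset.mem_filter.2 ⟨hb, ?_⟩⟩
    rw [Finset.filter_eq_empty_iff.2]
    · simpa using hN
    · intro x hx; exact not_lt.2 (hbmin x hx)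
  obtain ⟨v, hv, hvmax⟩ := Q.exists_max_image t hQne
  refine ⟨t v, (Finset.mem_filter.1 hv).2, ?_⟩
  rcases (S.filter (fun u => t v < t u)).eq_empty_or_nonempty with he | hne'
  · rw [he]; simpa using hN
  obtain ⟨w, hw, hwmin⟩ := Finset.exists_min_image _ t hne'
  rw [Finset.mem_filter] at hw
  have h1 : N ≤ (S.filter (fun u => t u < t w)).card := by
    by_contra hlt
    have : w ∈ Q := Finset.mem_filter.2 ⟨hw.1, not_le.1 hlt⟩
    exact absurd (hvmax w this) (not_le.2 hw.2)
  have h2 : (S.filter (fun u => t u < t w)).card + (S.filter (fun u => t v < t u)).card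
      ≤ S.card := by
    rw [← Finset.card_union_of_disjoint]
    · exact Finset.card_le_card (Finset.union_subset (Finset.filter_subset _ _)
        (Finset.filter_subset _ _))
    · rw [Finset.disjoint_left]
      intro x hx hx'
      exact absurd (hwmin x hx') (not_le.2 (Finset.mem_filter.1 hx).2)
  omega

open Classical in
/-- The combinatorial core: pointed intervals `lo ≤ t ≤ hi`. -/
lemma pointed_interval_subcoloring {V : Type*} (G : SimpleGraph V) (lo t hi : V → ℝ)
    (h1 : ∀ v, lo v ≤ t v) (h2 : ∀ v, t v ≤ hi v)
    (hA : ∀ u v, u ≠ v → lo u ≤ t v → t v ≤ hi u → G.Adj u v)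
    (hC : ∀ u v, G.Adj u v → lo u ≤ hi v) (m : ℕ) :
    ∀ S : Finset V, S.card < 2 ^ (m + 1) → ∃ μ : V → ℕ, (∀ v, μ v < 2 * m + 1) ∧
      ∀ u ∈ S, ∀ v ∈ S, ∀ w ∈ S, μ u = μ v → μ v = μ w → G.Adj u v → G.Adj v w → u ≠ w →
        G.Adj u w := by
  induction m with
  | zero =>
    intro S hS
    refine ⟨fun _ => 0, by simp, ?_⟩
    intro u hu v _ w hw _ _ _ _ hne
    exact absurd (Finset.card_le_one.1 (by omega : S.card ≤ 1) u hu w hw) hne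
  | succ m ih =>
    intro S hS
    obtain ⟨a, ha1, ha2⟩ := exists_median_level t S (2 ^ (m + 1)) (by positivity)
      (by rw [pow_succ] at hS; omega)
    obtain ⟨μL, hL, hL'⟩ := ih _ ha1
    obtain ⟨μR, hR, hR'⟩ := ih _ ha2
    simp only [Finset.mem_filter] at hL' hR'
    have hlow : ∀ u w, u ≠ w → t u ≤ a → t w ≤ a → a ≤ hi u → a ≤ hi w → G.Adj u w := by
      intro u w hne hu hw hu' hw'
      rcases le_total (t u) (t w) with hle | hle
      · exact hA u w hne ((h1 u).trans hle) (hw.trans hu')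
      · exact (hA w u hne.symm ((h1 w).trans hle) (hu.trans hw')).symm
    have hhigh : ∀ u w, u ≠ w → a ≤ t u → a ≤ t w → lo u ≤ a → lo w ≤ a → G.Adj u w := by
      intro u w hne hu hw hu' hw'
      rcases le_total (t u) (t w) with hle | hle
      · exact (hA w u hne.symm (hw'.trans hu) (hle.trans (h2 w))).symm
      · exact hA u w hne (hu'.trans hw) (hle.trans (h2 u))
    set μ : V → ℕ := fun v => if lo v ≤ a ∧ a ≤ hi v then
        (if t v ≤ a then 2 * m + 1 else 2 * m + 2)
      else if t v < a then μL v else μR v with hμ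
    have key : ∀ v, (μ v = 2 * m + 1 ∧ t v ≤ a ∧ a ≤ hi v) ∨
        (μ v = 2 * m + 2 ∧ a ≤ t v ∧ lo v ≤ a) ∨
        (μ v < 2 * m + 1 ∧ μ v = μL v ∧ t v < a ∧ hi v < a) ∨
        (μ v < 2 * m + 1 ∧ μ v = μR v ∧ a < t v ∧ a < lo v) := by
      intro v
      have e1 := h1 v
      have e2 := h2 v
      have e3 := hL v
      have e4 := hR v
      by_cases c1 : lo v ≤ a ∧ a ≤ hi v
      · by_cases c2 : t v ≤ a
        · left; simp only [hμ, if_pos c1, if_pos c2]; exact ⟨trivial, c2, c1.2⟩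
        · right; left; simp only [hμ, if_pos c1, if_neg c2]; exact ⟨trivial, by linarith, c1.1⟩
      · by_cases c2 : t v < a
        · right; right; left
          simp only [hμ, if_neg c1, if_pos c2]
          refine ⟨e3, trivial, c2, ?_⟩
          by_contra c3
          exact c1 ⟨by linarith, by linarith⟩
        · right; right; right
          simp only [hμ, if_neg c1, if_neg c2]
          have c3 : a < lo v := by
            by_contra c3
            exact c1 ⟨by linarith, by linarith⟩
          exact ⟨e4, trivial, by linarith, c3⟩
    refine ⟨μ, ?_, ?_⟩
    · intro v
      rcases key v with h | h | h | h <;> omega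
    · intro u hu v hv w hw huv hvw auv avw hne
      have f1 := hC u v auv
      have f2 := hC v u auv.symm
      have f3 := hC v w avw
      have f4 := hC w v avw.symm
      rcases key v with kv | kv | kv | kv <;> rcases key u with ku | ku | ku | ku <;>
        first
        | (exfalso; omega)
        | (exfalso; linarith [kv.2.2.2, ku.2.2.2])
        | (rcases key w with kw | kw | kw | kw <;>
            first
            | (exfalso; omega)
            | (exfalso; linarith [kv.2.2.2, kw.2.2.2])
            | exact hlow u w hne ku.2.1 kw.2.1 ku.2.2 kw.2.2
            | exact hhigh u w hne ku.2.1 kw.2.1 ku.2.2 kw.2.2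
            | exact hL' u ⟨hu, ku.2.2.1⟩ v ⟨hv, kv.2.2.1⟩ w ⟨hw, kw.2.2.1⟩
                (by omega) (by omega) auv avw hne
            | exact hR' u ⟨hu, ku.2.2.1⟩ v ⟨hv, kv.2.2.1⟩ w ⟨hw, kw.2.2.1⟩
                (by omega) (by omega) auv avw hne)

/-- Geometric core: if the norm range of the disk at `c` contains the square root of the power
of the origin with respect to the disk at `c'`, then the disks intersect. -/
lemma delta_disks_meet (c c' : EuclideanSpace ℝ (Fin 2)) (r r' : ℝ)
    (h0 : 0 < c 0) (h1 : 0 < c 1) (h0' : 0 < c' 0) (h1' : 0 < c' 1)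
    (hx' : c' 0 ≤ r') (hy' : c' 1 ≤ r') (hlt : r' < ‖c'‖)
    (hlo : ‖c‖ - r ≤ √(‖c'‖ ^ 2 - r' ^ 2)) (hhi : √(‖c'‖ ^ 2 - r' ^ 2) ≤ ‖c‖ + r) :
    (Metric.closedBall c r ∩ Metric.closedBall c' r').Nonempty := by
  set s := √(‖c'‖ ^ 2 - r' ^ 2) with hs
  have hr' : 0 < r' := h0'.trans_le hx'
  have hs2 : s ^ 2 = ‖c'‖ ^ 2 - r' ^ 2 := Real.sq_sqrt (by nlinarith)
  have hs0 : 0 ≤ s := Real.sqrt_nonneg _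
  have hn' : ‖c'‖ ^ 2 = c' 0 ^ 2 + c' 1 ^ 2 := by
    rw [EuclideanSpace.real_norm_sq_eq, Fin.sum_univ_two]
  have hn : ‖c‖ ^ 2 = c 0 ^ 2 + c 1 ^ 2 := by
    rw [EuclideanSpace.real_norm_sq_eq, Fin.sum_univ_two]
  have hpos : 0 < ‖c‖ := by
    rw [norm_pos_iff]; rintro rfl; simp at h0
  set d := ‖c‖ with hd
  have hsx : s ≤ c' 0 := by
    apply le_of_sq_le_sq _ h0'.le
    nlinarith
  have hsy : s ≤ c' 1 := by
    apply le_of_sq_le_sq _ h1'.le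
    nlinarith
  have hdxy : d ≤ c 0 + c 1 := by
    apply le_of_sq_le_sq _ (by positivity)
    nlinarith [mul_pos h0 h1]
  refine ⟨(s / d) • c, ?_, ?_⟩
  · rw [Metric.mem_closedBall, dist_eq_norm]
    have : (s / d) • c - c = ((s - d) / d) • c := by
      rw [sub_div, div_self hpos.ne', sub_smul, one_smul]
    rw [this, norm_smul, Real.norm_eq_abs, abs_div, abs_of_pos hpos, ← hd,
      div_mul_cancel₀ _ hpos.ne', abs_le]
    constructor <;> linarith
  · rw [Metric.mem_closedBall, dist_eq_norm]
    apply le_of_sq_le_sq _ hr'.le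
    rw [EuclideanSpace.real_norm_sq_eq, Fin.sum_univ_two]
    simp only [PiLp.sub_apply, PiLp.smul_apply, smul_eq_mul]
    set k := s / d with hk
    have hkd : k * d = s := div_mul_cancel₀ _ hpos.ne'
    have hk0 : 0 ≤ k := div_nonneg hs0 hpos.le
    have e1 : k ^ 2 * (c 0 ^ 2 + c 1 ^ 2) = s ^ 2 := by rw [← hn, ← hkd]; ring
    have e2 : s * d ≤ c 0 * c' 0 + c 1 * c' 1 := by nlinarith
    have e3 : s ^ 2 ≤ k * (c 0 * c' 0 + c 1 * c' 1) := by
      calc s ^ 2 = k * (s * d) := by rw [← hkd]; ring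
        _ ≤ _ := mul_le_mul_of_nonneg_left e2 hk0
    nlinarith

/-- Every Δ-disk graph on `n ≥ 1` vertices has subchromatic number at most
`2 log₂ n + 1`. -/
theorem deltaDiskGraph_subchromatic_le
    {V : Type*} [Fintype V] (hn : 1 ≤ Fintype.card V) (G : SimpleGraph V)
    (c : V → EuclideanSpace ℝ (Fin 2)) (r : V → ℝ)
    (h : IsDeltaDiskRep G c r) :
    ∃ (k : ℕ) (μ : V → Fin k), IsSubcoloring G μ ∧
      (k : ℝ) ≤ 2 * Real.logb 2 (Fintype.card V) + 1 := by
  obtain ⟨hx, hy, hmax, hr, hadj⟩ := h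
  simp only [dist_zero_right] at hr
  have hr0 : ∀ v, 0 < r v := fun v => (hx v).trans_le ((le_max_left _ _).trans (hmax v))
  obtain ⟨μ, hμ, hsub⟩ := pointed_interval_subcoloring G (fun v => ‖c v‖ - r v)
    (fun v => √(‖c v‖ ^ 2 - r v ^ 2)) (fun v => ‖c v‖ + r v)
    (fun v => Real.le_sqrt_of_sq_le (by nlinarith [hr0 v, hr v]))
    (fun v => (Real.sqrt_le_left (by linarith [hr0 v, hr v])).2 (by nlinarith [hr0 v, hr v]))
    (fun u v hne hlo hhi => (hadj u v hne).2
      (delta_disks_meet _ _ _ _ (hx u) (hy u) (hx v) (hy v) ((le_max_left _ _).trans (hmax v))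
        ((le_max_right _ _).trans (hmax v)) (hr v) hlo hhi))
    (by
      intro u v huv
      obtain ⟨q, hq1, hq2⟩ := (hadj u v huv.ne).1 huv
      rw [Metric.mem_closedBall, dist_eq_norm] at hq1 hq2
      have g1 := norm_sub_norm_le (c u) q
      have g2 := norm_sub_norm_le q (c v)
      rw [norm_sub_rev] at g1
      show ‖c u‖ - r u ≤ ‖c v‖ + r v
      linarith)
    (Nat.log 2 (Fintype.card V)) Finset.univ
    (by rw [Finset.card_univ]; exact Nat.lt_pow_succ_log_self (by norm_num) _)
  refine ⟨2 * Nat.log 2 (Fintype.card V) + 1, fun v => ⟨μ v, hμ v⟩, ?_, ?_⟩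
  · intro u v w h1 h2
    exact hsub u (Finset.mem_univ _) v (Finset.mem_univ _) w (Finset.mem_univ _)
      (Fin.mk.inj h1) (Fin.mk.inj h2)
  · have := Real.natLog_le_logb (Fintype.card V) 2
    push_cast at this ⊢
    linarith
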